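/- There is a universal constant c such that for every path-balance access (to element s in tree T with search path P, producing tree T') and every positive weight function w: |P| ≤ Φ_T(P) − Φ_{T'}(P) + c·(1 + log|P|)·(1 + log(W/w(s))). -/

import Mathlib

namespace Paper

inductive BTree where
  | nil : BTree
  | node : BTree → ℕ → BTree → BTree
deriving DecidableEq

namespace BTree

def keys : BTree → Finset ℕ
  | nil => ∅
  | node l x r => insert x (keys l ∪ keys r)

def root? : BTree → Option ℕ
  | nil => none
  | node _ x _ => some x

def isBST : BTree → Prop
  | nil => True
  | node l x r => (∀ y ∈ keys l, y < x) ∧ (∀ y ∈ keys r, x < y) ∧ isBST l ∧ isBST r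

def subtree? (s : ℕ) : BTree → Option BTree
  | nil => none
  | node l x r => if s = x then some (node l x r) else if s < x then subtree? s l else subtree? s r

/-- The set of keys of the subtree rooted at `s` (∅ if `s` is not in the tree). -/
def subtreeKeys (T : BTree) (s : ℕ) : Finset ℕ := ((subtree? s T).map keys).getD ∅

/-- The search path to `s`, listed from the root downwards. -/
def pathList (s : ℕ) : BTree → List ℕ
  | nil => []
  | node l x r => if s = x then [x] else if s < x then x :: pathList s l else x :: pathList s r

def pathSet (T : BTree) (s : ℕ) : Finset ℕ := (pathList s T).toFinset

def nodeDepth (s : ℕ) : BTree → ℕ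
  | nil => 0
  | node l x r => if s = x then 0 else if s < x then nodeDepth s l + 1 else nodeDepth s r + 1

/-- Number of right-going edges on the path from the root to `s`. -/
def rightDepth (s : ℕ) : BTree → ℕ
  | nil => 0
  | node l x r => if s = x then 0 else if s < x then rightDepth s l else rightDepth s r + 1

/-- Number of left-going edges on the path from the root to `s`. -/
def leftDepth (s : ℕ) : BTree → ℕ
  | nil => 0
  | node l x r => if s = x then 0 else if s < x then leftDepth s l + 1 else leftDepth s r

def leafCount : BTree → ℕ
  | nil => 0
  | node nil _ nil => 1
  | node l _ r => leafCount l + leafCount r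

/-- The wing partition of a BST, each wing listed from its topmost node downwards. -/
def wings : BTree → List (List ℕ)
  | nil => []
  | node l x r =>
    match wings l with
    | [] => [x] :: wings r
    | wl :: rest => (x :: wl) :: (rest ++ wings r)

end BTree

open BTree

/-- The left-leaning path on `[n]`: `n` at the root, `1` at the deepest node. -/
def leftPathTree : ℕ → BTree
  | 0 => BTree.nil
  | n + 1 => BTree.node (leftPathTree n) (n + 1) BTree.nil

/-- Number of side alternations (w.r.t. `s`) between adjacent elements of a list. -/
def sideAlt (s : ℕ) : List ℕ → ℕ
  | x :: y :: rest => (if (x < s ∧ s < y) ∨ (y < s ∧ s < x) then 1 else 0) + sideAlt s (y :: rest)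
  | _ => 0

/-- The set of elements involved in side alternations (w.r.t. `s`) in a list. -/
def zigzagSet (s : ℕ) : List ℕ → Finset ℕ
  | x :: y :: rest =>
    (if (x < s ∧ s < y) ∨ (y < s ∧ s < x) then ({x, y} : Finset ℕ) else ∅) ∪ zigzagSet s (y :: rest)
  | _ => ∅

noncomputable def wsum (w : ℕ → ℝ) (X : Finset ℕ) : ℝ := ∑ b ∈ X, w b

/-- Partial sum-of-logs potential of the set `X` in tree `T` (binary logarithm). -/
noncomputable def phiOn (w : ℕ → ℝ) (T : BTree) (X : Finset ℕ) : ℝ :=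
  ∑ a ∈ X, Real.logb 2 (wsum w (subtreeKeys T a))

noncomputable def phiAll (w : ℕ → ℝ) (T : BTree) : ℝ := phiOn w T (keys T)

/-- A single access of a minimally self-adjusting BST algorithm: the accessed element `s`
becomes the root, the keys are unchanged, and every node off the search path keeps its
subtree; hence the search path is replaced by an after-tree rooted at `s` and the pendent
subtrees are reattached in the unique order-preserving way. -/
structure IsAccess (T : BTree) (s : ℕ) (T' : BTree) : Prop where
  hT : isBST T
  hT' : isBST T'
  hs : s ∈ keys T
  hkeys : keys T' = keys T
  hroot : root? T' = some s
  hpendent : ∀ a ∈ keys T, a ∉ pathSet T s → subtree? a T' = subtree? a T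

/-- The algorithm (viewed as the set of accesses it may perform) satisfies the access lemma
via the sum-of-logs potential. -/
def SatisfiesAL (Alg : BTree → ℕ → BTree → Prop) : Prop :=
  ∃ C : ℝ, 0 ≤ C ∧ ∀ T s T', Alg T s T' → ∀ w : ℕ → ℝ, (∀ i ∈ keys T, 0 < w i) →
    ((pathSet T s).card : ℝ) ≤
      phiAll w T - phiAll w T' + C * (1 + Real.logb 2 (wsum w (keys T) / w s))

/-- `X` is subtree-disjoint (w.r.t. the tree after the access). -/
def SubtreeDisjoint (T' : BTree) (X : Finset ℕ) : Prop :=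
  ∀ a ∈ X, ∀ b ∈ X, a ≠ b → subtreeKeys T' a ∩ subtreeKeys T' b = ∅

/-- `X` is monotone: all elements on one side of `s`, with equal right-depth
(resp. left-depth) in the after-tree.  (For nodes of the search path, depth in the
after-tree coincides with depth in `T'`.) -/
def IsMonotone (s : ℕ) (T' : BTree) (X : Finset ℕ) : Prop :=
  ((∀ x ∈ X, s < x) ∧ ∃ d, ∀ x ∈ X, rightDepth x T' = d) ∨
  ((∀ x ∈ X, x < s) ∧ ∃ d, ∀ x ∈ X, leftDepth x T' = d)

/-- The after-tree minus its root can be partitioned into (at most) `k` monotone sets. -/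
def MonotoneDecomp (T : BTree) (s : ℕ) (T' : BTree) (k : ℕ) : Prop :=
  ∃ M : Fin k → Finset ℕ,
    (∀ i, IsMonotone s T' (M i)) ∧
    (∀ i j, i ≠ j → Disjoint (M i) (M j)) ∧
    Finset.univ.biUnion M = pathSet T s \ {s}

/-- The leaves of the after-tree: path nodes having no path node as proper descendant in `T'`. -/
def afterLeaves (T : BTree) (s : ℕ) (T' : BTree) : Finset ℕ :=
  (pathSet T s).filter (fun x => subtreeKeys T' x ∩ pathSet T s = {x})

/-- Rotate-to-root: `s` becomes the root and ancestor relations are otherwise preserved,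
equivalently `T'(a) = T(a) ∩ (-∞,s)` for path nodes `a < s` and symmetrically for `a > s`. -/
def IsRotateToRoot (T : BTree) (s : ℕ) (T' : BTree) : Prop :=
  subtreeKeys T' s = keys T ∧
  ∀ a ∈ pathSet T s,
    (a < s → subtreeKeys T' a = (subtreeKeys T a).filter (fun b => b < s)) ∧
    (s < a → subtreeKeys T' a = (subtreeKeys T a).filter (fun b => s < b))

def pendTree : Option ℕ → BTree
  | none => BTree.nil
  | some u => BTree.node BTree.nil u BTree.nil

def buildLeft (l : List (ℕ × Option ℕ)) : BTree :=
  l.foldl (fun t vc => BTree.node (pendTree vc.2) vc.1 t) BTree.nil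

def buildRight (l : List (ℕ × Option ℕ)) : BTree :=
  l.foldl (fun t vc => BTree.node t vc.1 (pendTree vc.2)) BTree.nil

/-- Global view of splay: process the reversed search path `v₁, v₂, …` in pairs; if a pair
lies on the same side of `s`, the more ancestral element is removed from its path and
becomes a (pendant) child of the other.  Returns the two spines (elements `< s` and `> s`),
deepest first, each spine node with its optional pendant child. -/
def splaySpines (s : ℕ) : List ℕ → List (ℕ × Option ℕ) × List (ℕ × Option ℕ)
  | [] => ([], [])
  | [v] => if v < s then ([(v, none)], []) else ([], [(v, none)])
  | v :: u :: rest =>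
    let p := splaySpines s rest
    if v < s then
      if u < s then ((v, some u) :: p.1, p.2)
      else ((v, none) :: p.1, (u, none) :: p.2)
    else
      if u < s then ((u, none) :: p.1, (v, none) :: p.2)
      else (p.1, (v, some u) :: p.2)

/-- The after-tree of a splay access, built from the reversed search path without `s`. -/
def splayAfterTree (s : ℕ) (l : List ℕ) : BTree :=
  BTree.node (buildLeft (splaySpines s l).1) s (buildRight (splaySpines s l).2)

/-- A splay access: a valid access whose after-tree (the restriction of `T'` to the search
path) is the splay after-tree. -/
def IsSplayAccess (T : BTree) (s : ℕ) (T' : BTree) : Prop :=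
  IsAccess T s T' ∧
  ∀ x ∈ pathSet T s,
    subtreeKeys T' x ∩ pathSet T s = subtreeKeys (splayAfterTree s (pathList s T).reverse.tail) x

/-- A path-balance access: a valid access whose after-tree is a balanced BST of depth
`⌈log₂ (1 + |P|)⌉` rooted at `s`. -/
def IsPathBalanceAccess (T : BTree) (s : ℕ) (T' : BTree) : Prop :=
  IsAccess T s T' ∧
  ∀ x ∈ pathSet T s, nodeDepth x T' ≤ Nat.clog 2 (1 + (pathSet T s).card)

def isParent (Q : BTree) (x y : ℕ) : Prop := pathList y Q = pathList x Q ++ [y]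

/-- One step of a decomposition: a (descending) path `Pi` of `Q` is rearranged into a tree,
all other nodes keeping their subtrees. -/
def StepRel (Q Q' : BTree) (Pi : Finset ℕ) : Prop :=
  isBST Q' ∧ keys Q' = keys Q ∧
  (∃ l : List ℕ, l ≠ [] ∧ List.Chain' (isParent Q) l ∧ l.toFinset = Pi) ∧
  (∀ a ∈ keys Q, a ∉ Pi → subtree? a Q' = subtree? a Q)

/-- The transformation of the before-path `P0` (as a tree) into the after-tree `A` admits a
local decomposition with window size `wdw`. -/
def HasLocalDecomp (s : ℕ) (P0 A : BTree) (wdw : ℕ) : Prop :=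
  ∃ (k : ℕ) (Q : ℕ → BTree) (Ps : ℕ → Finset ℕ),
    1 ≤ k ∧ Q 0 = P0 ∧ Q k = A ∧
    (∀ i < k, StepRel (Q i) (Q (i + 1)) (Ps i)) ∧
    s ∈ Ps 0 ∧
    (∀ i, i + 1 < k → (Ps (i + 1) \ Ps i).Nonempty) ∧
    (∀ i, i + 1 < k → (Ps (i + 1) ∩ Ps i).Nonempty) ∧
    (∀ i j, i + 1 < j → j < k → Disjoint (Ps i \ Ps (i + 1)) (Ps j)) ∧
    (∀ i < k, (Ps i).card ≤ wdw)

/-- The search path to `s` in `T`, as a tree (the before-path of the transformation). -/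
def pathTree (s : ℕ) : BTree → BTree
  | BTree.nil => BTree.nil
  | BTree.node l x r =>
    if s = x then BTree.node BTree.nil x BTree.nil
    else if s < x then BTree.node (pathTree s l) x BTree.nil
    else BTree.node BTree.nil x (pathTree s r)

/-- `A` is the after-tree of the access `(T, s, T')`: the restriction of `T'` to the search path. -/
def IsAfterTree (T : BTree) (s : ℕ) (T' A : BTree) : Prop :=
  isBST A ∧ keys A = pathSet T s ∧
  ∀ x ∈ pathSet T s, subtreeKeys A x = subtreeKeys T' x ∩ pathSet T s

/-- The algorithm is local with window size `wdw`. -/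
def IsLocal (Alg : BTree → ℕ → BTree → Prop) (wdw : ℕ) : Prop :=
  ∀ T s T', Alg T s T' → ∀ A, IsAfterTree T s T' A → HasLocalDecomp s (pathTree s T) A wdw

open scoped Classical in
noncomputable def stair (n : ℕ) (h : ℕ → ℕ) (s : ℕ) : Finset ℕ :=
  (Finset.Icc 1 n).filter
    (fun b => ∀ b' ∈ Finset.Icc 1 n, ((s < b' ∧ b' < b) ∨ (b < b' ∧ b' < s)) → h b' < h b)

open scoped Classical in
noncomputable def nbhd (n : ℕ) (h : ℕ → ℕ) (a : ℕ) : Finset ℕ :=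
  (Finset.Icc 1 n).filter
    (fun b => ∀ b' ∈ Finset.Icc 1 n, b' ≠ a → min a b ≤ b' → b' ≤ max a b → h b' < h a)

/-- Geometric sum-of-logs partial potential. -/
noncomputable def phiGeo (n : ℕ) (h : ℕ → ℕ) (w : ℕ → ℝ) (X : Finset ℕ) : ℝ :=
  ∑ a ∈ X, Real.logb 2 (wsum w (nbhd n h a))

/-- `l` is (the reversal of) a valid search path to `s`, without `s`, deepest element first. -/
def ValidRevPath (s : ℕ) (l : List ℕ) : Prop :=
  l.Nodup ∧ s ∉ l ∧
  l.Pairwise (fun a b => (a < s → b < s → b < a) ∧ (s < a → s < b → a < b))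

end Paper

namespace Paper

namespace BTree

theorem subtreeKeys_node (l r : BTree) (x a : ℕ) :
    subtreeKeys (node l x r) a =
      if a = x then keys (node l x r) else if a < x then subtreeKeys l a else subtreeKeys r a := by
  unfold subtreeKeys
  rw [subtree?]
  split_ifs <;> simp

theorem subtreeKeys_subset_keys (T : BTree) (a : ℕ) : subtreeKeys T a ⊆ keys T := by
  induction T with
  | nil => simp [subtreeKeys, subtree?]
  | node l x r hl hr =>
    rw [subtreeKeys_node]
    intro y hy
    split_ifs at hy
    · exact hy
    · simp [keys, hl hy]
    · simp [keys, hr hy]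

theorem mem_subtreeKeys_self {T : BTree} (hT : isBST T) {a : ℕ} (ha : a ∈ keys T) :
    a ∈ subtreeKeys T a := by
  induction T with
  | nil => simp [keys] at ha
  | node l x r hl hr =>
    obtain ⟨h1, h2, h3, h4⟩ := hT
    rw [subtreeKeys_node]
    simp only [keys, Finset.mem_insert, Finset.mem_union] at ha
    split_ifs with h h'
    · simp [keys, h]
    · exact hl h3 (by grind)
    · exact hr h4 (by grind)

theorem mem_subtreeKeys_of_between {T : BTree} (hT : isBST T) {a x y z : ℕ}
    (hx : x ∈ subtreeKeys T a) (hz : z ∈ subtreeKeys T a) (hy : y ∈ keys T)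
    (hxy : x ≤ y) (hyz : y ≤ z) : y ∈ subtreeKeys T a := by
  induction T with
  | nil => simp [keys] at hy
  | node l b r hl hr =>
    obtain ⟨h1, h2, h3, h4⟩ := hT
    have hl' := subtreeKeys_subset_keys l a
    have hr' := subtreeKeys_subset_keys r a
    rw [subtreeKeys_node] at hx hz ⊢
    simp only [keys, Finset.mem_insert, Finset.mem_union] at hy
    split_ifs at hx hz ⊢ with h h'
    · simpa [keys] using hy
    · exact hl h3 hx hz (by grind)
    · exact hr h4 hx hz (by grind)

theorem subtreeKeys_subset_subtreeKeys {T : BTree} (hT : isBST T) {a b : ℕ}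
    (hb : b ∈ subtreeKeys T a) : subtreeKeys T b ⊆ subtreeKeys T a := by
  induction T with
  | nil => simp [subtreeKeys, subtree?]
  | node l x r hl hr =>
    obtain ⟨h1, h2, h3, h4⟩ := hT
    have hl' := subtreeKeys_subset_keys l a
    have hr' := subtreeKeys_subset_keys r a
    have hall := subtreeKeys_subset_keys (node l x r) b
    rw [subtreeKeys_node l r x a] at hb ⊢
    split_ifs at hb ⊢ with h h'
    · exact hall
    · have : b < x := h1 b (hl' hb)
      rw [subtreeKeys_node, if_neg this.ne, if_pos this]
      exact hl h3 hb
    · have : x < b := h2 b (hr' hb)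
      rw [subtreeKeys_node, if_neg this.ne', if_neg this.not_gt]
      exact hr h4 hb

theorem pathSet_subset_keys (T : BTree) (s : ℕ) : pathSet T s ⊆ keys T := by
  induction T with
  | nil => simp [pathSet, pathList]
  | node l x r hl hr =>
    intro a ha
    simp only [pathSet, List.mem_toFinset, Finset.subset_iff] at ha hl hr
    rw [pathList] at ha
    simp only [keys, Finset.mem_insert, Finset.mem_union]
    split_ifs at ha <;> grind

theorem mem_subtreeKeys_of_mem_pathSet {T : BTree} (hT : isBST T) {s a : ℕ}
    (hs : s ∈ keys T) (ha : a ∈ pathSet T s) : s ∈ subtreeKeys T a := by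
  induction T with
  | nil => simp [keys] at hs
  | node l x r hl hr =>
    obtain ⟨h1, h2, h3, h4⟩ := hT
    have hl' := pathSet_subset_keys l s
    have hr' := pathSet_subset_keys r s
    rw [subtreeKeys_node]
    have hs' := hs
    simp only [keys, Finset.mem_insert, Finset.mem_union] at hs'
    simp only [pathSet, List.mem_toFinset, Finset.subset_iff] at ha hl hr hl' hr'
    rw [pathList] at ha
    grind

theorem mem_pathSet_self {T : BTree} (hT : isBST T) {s : ℕ} (hs : s ∈ keys T) :
    s ∈ pathSet T s := by
  induction T with
  | nil => simp [keys] at hs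
  | node l x r hl hr =>
    obtain ⟨h1, h2, h3, h4⟩ := hT
    simp only [keys, Finset.mem_insert, Finset.mem_union] at hs
    simp only [pathSet, List.mem_toFinset] at hl hr ⊢
    rw [pathList]
    grind

theorem disjoint_subtreeKeys_of_nodeDepth_eq {T : BTree} (hT : isBST T) {a b : ℕ}
    (hd : nodeDepth a T = nodeDepth b T) (hab : a ≠ b) :
    Disjoint (subtreeKeys T a) (subtreeKeys T b) := by
  induction T with
  | nil => simp [subtreeKeys, subtree?]
  | node l x r hl hr =>
    obtain ⟨h1, h2, h3, h4⟩ := hT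
    have ha := subtreeKeys_subset_keys l a
    have ha' := subtreeKeys_subset_keys r a
    have hb := subtreeKeys_subset_keys l b
    have hb' := subtreeKeys_subset_keys r b
    rw [subtreeKeys_node, subtreeKeys_node]
    rw [nodeDepth, nodeDepth] at hd
    rw [Finset.disjoint_left] at hl hr ⊢
    grind

theorem notMem_subtreeKeys_of_root {T : BTree} (hT : isBST T) {s b : ℕ}
    (hroot : root? T = some s) (hb : b ≠ s) : s ∉ subtreeKeys T b := by
  cases T with
  | nil => simp [root?] at hroot
  | node l x r =>
    obtain ⟨h1, h2, h3, h4⟩ := hT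
    obtain rfl : x = s := by simpa [root?] using hroot
    have hl := subtreeKeys_subset_keys l b
    have hr := subtreeKeys_subset_keys r b
    rw [subtreeKeys_node, if_neg hb]
    grind

end BTree

open BTree

theorem one_add_logb_two_le {x : ℝ} (hx : 0 < x) : 1 + Real.logb 2 x ≤ 2 * x := by
  have h1 := Real.log_le_sub_one_of_pos hx
  have h2 := Real.log_two_gt_d9
  have h3 := Real.log_two_lt_d9
  have h4 : Real.logb 2 x * Real.log 2 = Real.log x := by
    rw [Real.logb, div_mul_cancel₀ _ (by linarith)]
  nlinarith

theorem sub_one_le_two_mul_logb_two {r : ℝ} (h1 : 1 ≤ r) (h2 : r ≤ 2) :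
    r - 1 ≤ 2 * Real.logb 2 r := by
  have h3 := Real.one_sub_inv_le_log_of_pos (show 0 < r by linarith)
  have h4 := Real.log_two_gt_d9
  have h5 := Real.log_two_lt_d9
  have h6 : Real.logb 2 r * Real.log 2 = Real.log r := by
    rw [Real.logb, div_mul_cancel₀ _ (by linarith)]
  have h7 : 0 ≤ Real.logb 2 r := Real.logb_nonneg (by norm_num) h1
  have h8 : (r - 1) / 2 ≤ 1 - r⁻¹ := by
    have : 1 - r⁻¹ - (r - 1) / 2 = (r - 1) * (2 - r) / (2 * r) := by field_simp
    have : 0 ≤ (r - 1) * (2 - r) / (2 * r) :=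
      div_nonneg (mul_nonneg (by linarith) (by linarith)) (by linarith)
    linarith
  nlinarith

theorem one_add_logb_div_le {t g G S : ℝ} (ht : 0 < t) (hg : 0 < g) (hgG : g ≤ G)
    (hS : 0 ≤ S) (hSg : S ≤ g) (hStG : S + t ≤ G) :
    1 + Real.logb 2 (t / g) ≤ 4 * Real.logb 2 (G / g) + 2 * ((S + t) / G) - 2 * (S / g) := by
  have hG : 0 < G := hg.trans_le hgG
  have hq : S / g ≤ 1 := (div_le_one hg).2 hSg
  have hp0 : 0 ≤ (S + t) / G := by positivity
  have hp1 : (S + t) / G ≤ 1 := (div_le_one hG).2 hStG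
  rcases le_total 2 (G / g) with h | h
  · have h1 : 1 ≤ Real.logb 2 (G / g) := by
      rw [Real.le_logb_iff_rpow_le (by norm_num) (by positivity)]
      simpa using h
    have h2 : Real.logb 2 (t / g) ≤ Real.logb 2 (G / g) :=
      Real.logb_le_logb_of_le (by norm_num) (by positivity) (by gcongr; linarith)
    linarith
  · have h0 : 1 ≤ G / g := (one_le_div hg).2 hgG
    have h1 := sub_one_le_two_mul_logb_two h0 h
    have h2 := one_add_logb_two_le (show 0 < t / g by positivity)
    have h3 : t / g = (S + t) / G * (G / g) - S / g := by field_simp; ring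
    have h4 : (S + t) / G * (G / g - 1) ≤ G / g - 1 := mul_le_of_le_one_left (by linarith) hp1
    linarith

/-- Weights `t` that pack, in order of `f`, into the growing capacities `g` have a total
log-ratio bounded by the overall growth of the capacity. -/
theorem sum_one_add_logb_le {t g : ℕ → ℝ} {m : ℝ} (hm : 0 < m) (f : ℕ → ℕ) (X : Finset ℕ)
    (ht : ∀ a ∈ X, 0 < t a) (hmg : ∀ a ∈ X, m ≤ g a)
    (hmono : ∀ a ∈ X, ∀ b ∈ X, f b ≤ f a → g b ≤ g a)
    (hpack : ∀ a ∈ X, ∀ Y ⊆ X, a ∉ Y → (∀ b ∈ Y, f b ≤ f a) → ∑ b ∈ Y, t b ≤ g a)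
    {G : ℝ} (hmG : m ≤ G) (hgG : ∀ a ∈ X, g a ≤ G) (htG : ∑ b ∈ X, t b ≤ G) :
    ∑ a ∈ X, (1 + Real.logb 2 (t a / g a)) ≤
      4 * Real.logb 2 (G / m) + 2 * ((∑ b ∈ X, t b) / G) := by
  induction X using Finset.induction_on_max_value f generalizing G with
  | empty =>
    have : 0 ≤ Real.logb 2 (G / m) := Real.logb_nonneg (by norm_num) ((one_le_div hm).2 hmG)
    simpa using this
  | insert a Y haY hmax ih =>
    simp only [Finset.mem_insert, forall_eq_or_imp] at ht hmg hgG
    have hYX : Y ⊆ insert a Y := Finset.subset_insert _ _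
    have haX : a ∈ insert a Y := Finset.mem_insert_self _ _
    have hYa : ∑ b ∈ Y, t b ≤ g a := hpack a haX Y hYX haY hmax
    have hga : 0 < g a := hm.trans_le hmg.1
    have hG : 0 < G := hm.trans_le hmG
    have hY := ih ht.2 hmg.2 (fun a ha b hb => hmono a (hYX ha) b (hYX hb))
      (fun a ha Z hZ => hpack a (hYX ha) Z (hZ.trans hYX)) hmg.1
      (fun b hb => hmono a haX b (hYX hb) (hmax b hb)) hYa
    rw [Finset.sum_insert haY] at htG ⊢
    rw [Finset.sum_insert haY]
    have hstep := one_add_logb_div_le ht.1 hga hgG.1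
      (Finset.sum_nonneg fun b hb => (ht.2 b hb).le) hYa (by linarith)
    have hsplit : Real.logb 2 (G / m) = Real.logb 2 (G / g a) + Real.logb 2 (g a / m) := by
      rw [← Real.logb_mul (by positivity) (by positivity), div_mul_div_cancel₀ hga.ne']
    rw [add_comm (t a)]
    linarith

theorem wsum_mono {w : ℕ → ℝ} {X Y Z : Finset ℕ} (hw : ∀ i ∈ Z, 0 < w i) (hYZ : Y ⊆ Z)
    (hXY : X ⊆ Y) : wsum w X ≤ wsum w Y :=
  Finset.sum_le_sum_of_subset_of_nonneg hXY fun i hi _ => (hw i (hYZ hi)).le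

theorem le_wsum {w : ℕ → ℝ} {X Z : Finset ℕ} {a : ℕ} (hw : ∀ i ∈ Z, 0 < w i) (hXZ : X ⊆ Z)
    (ha : a ∈ X) : w a ≤ wsum w X :=
  Finset.single_le_sum (f := w) (fun i hi => (hw i (hXZ hi)).le) ha

theorem sum_wsum_le {w : ℕ → ℝ} {Y Z V : Finset ℕ} {F : ℕ → Finset ℕ} (hw : ∀ i ∈ V, 0 < w i)
    (hZ : Z ⊆ V) (hF : ∀ b ∈ Y, F b ⊆ Z)
    (hdisj : ∀ a ∈ Y, ∀ b ∈ Y, a ≠ b → Disjoint (F a) (F b)) :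
    ∑ b ∈ Y, wsum w (F b) ≤ wsum w Z := by
  unfold wsum
  rw [← Finset.sum_biUnion (fun a ha b hb hab => hdisj a ha b hb hab)]
  exact wsum_mono hw hZ (Finset.biUnion_subset.2 hF)

/-- Path nodes on one side of `s` whose subtrees after the access are pairwise disjoint. -/
theorem sum_one_add_logb_le_of_oneSided {T T' : BTree} {s : ℕ} (h : IsAccess T s T')
    {w : ℕ → ℝ} (hw : ∀ i ∈ keys T, 0 < w i) {X : Finset ℕ} (hX : X ⊆ pathSet T s)
    (hside : (∀ x ∈ X, x < s) ∨ (∀ x ∈ X, s < x))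
    (hdisj : ∀ a ∈ X, ∀ b ∈ X, a ≠ b → Disjoint (subtreeKeys T' a) (subtreeKeys T' b)) :
    ∑ a ∈ X, (1 + Real.logb 2 (wsum w (subtreeKeys T' a) / wsum w (subtreeKeys T a))) ≤
      4 * Real.logb 2 (wsum w (keys T) / w s) + 2 := by
  have hXk : X ⊆ keys T := hX.trans (pathSet_subset_keys T s)
  have hsub : ∀ a, subtreeKeys T a ⊆ keys T := subtreeKeys_subset_keys T
  have hsub' : ∀ a, subtreeKeys T' a ⊆ keys T := fun a =>
    h.hkeys ▸ subtreeKeys_subset_keys T' a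
  have hself : ∀ a ∈ X, a ∈ subtreeKeys T a := fun a ha => mem_subtreeKeys_self h.hT (hXk ha)
  have hself' : ∀ a ∈ X, a ∈ subtreeKeys T' a := fun a ha =>
    mem_subtreeKeys_self h.hT' (h.hkeys ▸ hXk ha)
  have hs : ∀ a ∈ X, s ∈ subtreeKeys T a := fun a ha =>
    mem_subtreeKeys_of_mem_pathSet h.hT h.hs (hX ha)
  have hs' : ∀ a ∈ X, s ∉ subtreeKeys T' a := fun a ha =>
    notMem_subtreeKeys_of_root h.hT' h.hroot (by rcases hside with h | h <;> grind)
  have hbtw' : ∀ a x y z, x ∈ subtreeKeys T' a → z ∈ subtreeKeys T' a → y ∈ keys T →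
      x ≤ y → y ≤ z → y ∈ subtreeKeys T' a := fun a x y z hx hz hy =>
    mem_subtreeKeys_of_between h.hT' hx hz (h.hkeys ▸ hy)
  have hbtw : ∀ a x y z, x ∈ subtreeKeys T a → z ∈ subtreeKeys T a → y ∈ keys T →
      x ≤ y → y ≤ z → y ∈ subtreeKeys T a := fun a x y z hx hz hy =>
    mem_subtreeKeys_of_between h.hT hx hz hy
  have hnest : ∀ a ∈ X, ∀ b ∈ X, (b - s) + (s - b) ≤ (a - s) + (s - a) →
      subtreeKeys T b ⊆ subtreeKeys T a := by
    intro a ha b hb hba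
    refine subtreeKeys_subset_subtreeKeys h.hT ?_
    rcases hside with hside | hside
    · have := hside a ha
      have := hside b hb
      exact hbtw a a b s (hself a ha) (hs a ha) (hXk hb) (by omega) (by omega)
    · have := hside a ha
      have := hside b hb
      exact hbtw a s b a (hs a ha) (hself a ha) (hXk hb) (by omega) (by omega)
  have hnest' : ∀ a ∈ X, ∀ b ∈ X, a ≠ b → (b - s) + (s - b) ≤ (a - s) + (s - a) →
      subtreeKeys T' b ⊆ subtreeKeys T a := by
    intro a ha b hb hab hba y hy
    have hab' : a ∉ subtreeKeys T' b := Finset.disjoint_left.1 (hdisj a ha b hb hab) (hself' a ha)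
    have hsb := hs' b hb
    have hya : y ∈ keys T := hsub' b hy
    rcases hside with hside | hside
    · have := hside a ha
      have := hside b hb
      have h1 : a ≤ y := by
        by_contra! hlt
        exact hab' (hbtw' b y a b hy (hself' b hb) (hXk ha) hlt.le (by omega))
      have h2 : y ≤ s := by
        by_contra! hlt
        exact hsb (hbtw' b b s y (hself' b hb) hy h.hs (by omega) hlt.le)
      exact hbtw a a y s (hself a ha) (hs a ha) hya h1 h2
    · have := hside a ha
      have := hside b hb
      have h1 : y ≤ a := by
        by_contra! hlt
        exact hab' (hbtw' b b a y (hself' b hb) hy (hXk ha) (by omega) hlt.le)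
      have h2 : s ≤ y := by
        by_contra! hlt
        exact hsb (hbtw' b y s b hy (hself' b hb) h.hs hlt.le (by omega))
      exact hbtw a s y a (hs a ha) (hself a ha) hya h2 h1
  have hws : 0 < w s := hw s h.hs
  have htotal : ∑ b ∈ X, wsum w (subtreeKeys T' b) ≤ wsum w (keys T) :=
    sum_wsum_le hw subset_rfl (fun b _ => hsub' b) hdisj
  have hmW : w s ≤ wsum w (keys T) := le_wsum hw subset_rfl h.hs
  have hmain := sum_one_add_logb_le (t := fun a => wsum w (subtreeKeys T' a))
    (g := fun a => wsum w (subtreeKeys T a)) hws (fun a => (a - s) + (s - a)) X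
    (fun a ha => (hw a (hXk ha)).trans_le (le_wsum hw (hsub' a) (hself' a ha)))
    (fun a ha => le_wsum hw (hsub a) (hs a ha))
    (fun a ha b hb hba => wsum_mono hw (hsub a) (hnest a ha b hb hba))
    (fun a ha Y hY haY hmax => sum_wsum_le hw (hsub a)
      (fun b hb => hnest' a ha b (hY hb) (fun e => haY (e ▸ hb)) (hmax b hb))
      (fun b hb c hc => hdisj b (hY hb) c (hY hc)))
    hmW (fun a _ => wsum_mono hw subset_rfl (hsub a)) htotal
  have : (∑ b ∈ X, wsum w (subtreeKeys T' b)) / wsum w (keys T) ≤ 1 :=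
    (div_le_one (hws.trans_le hmW)).2 htotal
  linarith

theorem clog_two_one_add_le {p : ℕ} (hp : 0 < p) :
    (Nat.clog 2 (1 + p) : ℝ) ≤ 1 + Real.logb 2 p := by
  have h1 : 2 ^ (Nat.clog 2 (1 + p)).pred < 1 + p :=
    Nat.pow_pred_clog_lt_self (by norm_num) (by omega)
  have h2 : (2 : ℝ) ^ (Nat.clog 2 (1 + p)).pred ≤ p := by
    exact_mod_cast Nat.lt_one_add_iff.1 h1
  have h3 : ((Nat.clog 2 (1 + p)).pred : ℝ) ≤ Real.logb 2 p := by
    rw [Real.le_logb_iff_rpow_le (by norm_num) (by exact_mod_cast hp), Real.rpow_natCast]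
    exact h2
  have h4 : (Nat.clog 2 (1 + p) : ℝ) ≤ 1 + ((Nat.clog 2 (1 + p)).pred : ℝ) := by
    exact_mod_cast (by rw [Nat.pred_eq_sub_one]; omega :
      Nat.clog 2 (1 + p) ≤ 1 + (Nat.clog 2 (1 + p)).pred)
  linarith

end Paper

open Paper Paper.BTree
/-- **Lemma (path-balance).** There is a universal constant `c` such that for every
path-balance access: `|P| ≤ Φ_T(P) − Φ_{T'}(P) + c·(1 + log |P|)·(1 + log(W / w(s)))`. -/
theorem path_balance_lemma :
    ∃ c : ℝ, 0 ≤ c ∧ ∀ T s T', IsPathBalanceAccess T s T' →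
      ∀ w : ℕ → ℝ, (∀ i ∈ keys T, 0 < w i) →
        ((pathSet T s).card : ℝ) ≤
          phiOn w T (pathSet T s) - phiOn w T' (pathSet T s) +
            c * (1 + Real.logb 2 ((pathSet T s).card)) *
              (1 + Real.logb 2 (wsum w (keys T) / w s)) := by
  refine ⟨24, by norm_num, fun T s T' ⟨h, hdepth⟩ w hw => ?_⟩
  set P := pathSet T s
  set L := Real.logb 2 (wsum w (keys T) / w s)
  let D := Nat.clog 2 (1 + P.card)
  let F : ℕ → ℝ := fun a =>
    1 + Real.logb 2 (wsum w (subtreeKeys T' a) / wsum w (subtreeKeys T a))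
  have hPk : P ⊆ keys T := pathSet_subset_keys T s
  have hsP : s ∈ P := mem_pathSet_self h.hT h.hs
  have hsub : ∀ a, subtreeKeys T a ⊆ keys T := subtreeKeys_subset_keys T
  have hsub' : ∀ a, subtreeKeys T' a ⊆ keys T := fun a =>
    h.hkeys ▸ subtreeKeys_subset_keys T' a
  have hpos : ∀ a ∈ P, 0 < wsum w (subtreeKeys T a) := fun a ha =>
    (hw a (hPk ha)).trans_le (le_wsum hw (hsub a) (mem_subtreeKeys_self h.hT (hPk ha)))
  have hpos' : ∀ a ∈ P, 0 < wsum w (subtreeKeys T' a) := fun a ha =>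
    (hw a (hPk ha)).trans_le
      (le_wsum hw (hsub' a) (mem_subtreeKeys_self h.hT' (h.hkeys ▸ hPk ha)))
  have hws : 0 < w s := hw s h.hs
  have hL : 0 ≤ L := Real.logb_nonneg (by norm_num)
    ((one_le_div hws).2 (le_wsum hw subset_rfl h.hs))
  have hsum : ∑ a ∈ P, F a = P.card - (phiOn w T P - phiOn w T' P) := by
    rw [Finset.sum_add_distrib, phiOn, phiOn, Finset.sum_congr rfl fun a ha =>
      Real.logb_div (hpos' a ha).ne' (hpos a ha).ne', Finset.sum_sub_distrib]
    simp only [Finset.sum_const, nsmul_eq_mul, mul_one]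
    ring
  have hFs : F s ≤ 1 + L := by
    have : wsum w (subtreeKeys T' s) / wsum w (subtreeKeys T s) ≤ wsum w (keys T) / w s :=
      div_le_div₀ (hws.le.trans (le_wsum hw subset_rfl h.hs))
        (wsum_mono hw subset_rfl (hsub' s)) hws
        (le_wsum hw (hsub s) (mem_subtreeKeys_self h.hT h.hs))
    have := Real.logb_le_logb_of_le (b := 2) (by norm_num)
      (div_pos (hpos' s hsP) (hpos s hsP)) this
    simpa [F, L] using this
  have hside : ∀ Q : Finset ℕ, Q ⊆ P → ((∀ x ∈ Q, x < s) ∨ (∀ x ∈ Q, s < x)) →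
      ∑ a ∈ Q, F a ≤ (D + 1) * (4 * L + 2) := by
    intro Q hQ hQs
    have hmaps : ∀ a ∈ Q, nodeDepth a T' ∈ Finset.range (D + 1) := fun a ha =>
      Finset.mem_range.2 (Nat.lt_succ_of_le (hdepth a (hQ ha)))
    rw [← Finset.sum_fiberwise_of_maps_to hmaps]
    refine (Finset.sum_le_card_nsmul _ _ (4 * L + 2) fun d _ => ?_).trans_eq
      (by rw [Finset.card_range, nsmul_eq_mul]; push_cast; rfl)
    refine sum_one_add_logb_le_of_oneSided h hw ((Finset.filter_subset _ _).trans hQ)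
      (hQs.imp (fun H x hx => H x (Finset.mem_filter.1 hx).1)
        (fun H x hx => H x (Finset.mem_filter.1 hx).1)) fun a ha b hb hab => ?_
    exact disjoint_subtreeKeys_of_nodeDepth_eq h.hT'
      ((Finset.mem_filter.1 ha).2.trans (Finset.mem_filter.1 hb).2.symm) hab
  have hsplit : ∑ a ∈ P, F a =
      F s + (∑ a ∈ P with a < s, F a + ∑ a ∈ P with s < a, F a) := by
    rw [← Finset.add_sum_erase P F hsP,
      ← Finset.sum_filter_add_sum_filter_not (P.erase s) (· < s)]
    congr 3 <;> ext a <;> grind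
  have h1 := hside {a ∈ P | a < s} (Finset.filter_subset _ _) (Or.inl (by simp))
  have h2 := hside {a ∈ P | s < a} (Finset.filter_subset _ _) (Or.inr (by simp))
  have hD : (D : ℝ) ≤ 1 + Real.logb 2 P.card := clog_two_one_add_le (Finset.card_pos.2 ⟨s, hsP⟩)
  have hp : 0 ≤ Real.logb 2 P.card :=
    Real.logb_nonneg (by norm_num) (by exact_mod_cast Finset.card_pos.2 ⟨s, hsP⟩)
  nlinarith [mul_nonneg hp hL, mul_nonneg (sub_nonneg.2 hD) hL]
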